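/- Let f : ℝ^m → ℝ^m be given coordinatewise by f(x_1, …, x_m) = (f_1(x_1), …, f_m(x_m)), where each f_i : ℝ → ℝ is continuous and nondecreasing, and let u be an m-cell fuzzy number with [u]_θ = Π_{i=1}^m [u_i⁻(θ), u_i⁺(θ)]. Then the Zadeh extension f(u) is an m-cell fuzzy number and, for every θ ∈ [0,1], [f(u)]_θ = Π_{i=1}^m [f_i(u_i⁻(θ)), f_i(u_i⁺(θ))]. -/

import Mathlib

open Set

/-- The α-cut of a fuzzy set: for α ≠ 0 it is `{x | α ≤ u x}`;
for α = 0 it is the closure of `{x | 0 < u x}`. -/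
noncomputable def cut {X : Type*} [TopologicalSpace X] (u : X → ℝ) (α : ℝ) : Set X :=
  if α = 0 then closure {x | 0 < u x} else {x | α ≤ u x}

/-- The Zadeh extension of `f` applied to the fuzzy set `u`:
`zadeh f u y = sup { u x : f x = y }`, with `sSup ∅ = 0` in ℝ. -/
noncomputable def zadeh {X Y : Type*} (f : X → Y) (u : X → ℝ) : Y → ℝ :=
  fun y => sSup {t : ℝ | ∃ x, f x = y ∧ t = u x}

/-- An m-cell fuzzy number: a fuzzy set on ℝ^m all of whose α-cuts, α ∈ [0,1],
are nonempty compact cells `Π_k [a k, b k]`. -/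
def IsCellFuzzyNumber {m : ℕ} (u : (Fin m → ℝ) → ℝ) : Prop :=
  (∀ x, u x ∈ Icc (0 : ℝ) 1) ∧
  ∀ α ∈ Icc (0 : ℝ) 1, ∃ a b : Fin m → ℝ, (∀ k, a k ≤ b k) ∧
    cut u α = Set.univ.pi (fun k => Icc (a k) (b k))

theorem zadeh_mem_Icc {X Y : Type*} {f : X → Y} {u : X → ℝ} (hu : ∀ x, u x ∈ Icc (0 : ℝ) 1)
    (y : Y) : zadeh f u y ∈ Icc (0 : ℝ) 1 := by
  constructor
  · apply Real.sSup_nonneg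
    rintro _ ⟨x, -, rfl⟩
    exact (hu x).1
  · refine Real.sSup_le ?_ zero_le_one
    rintro _ ⟨x, -, rfl⟩
    exact (hu x).2

theorem le_zadeh {X Y : Type*} (f : X → Y) {u : X → ℝ} (hu : ∀ x, u x ∈ Icc (0 : ℝ) 1) (x : X) :
    u x ≤ zadeh f u (f x) := by
  refine le_csSup ⟨1, ?_⟩ ⟨x, rfl, rfl⟩
  rintro _ ⟨z, -, rfl⟩
  exact (hu z).2

theorem exists_lt_of_lt_zadeh {X Y : Type*} {f : X → Y} {u : X → ℝ} {y : Y} {β : ℝ}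
    (hβ : 0 ≤ β) (h : β < zadeh f u y) : ∃ x, f x = y ∧ β < u x := by
  by_contra! hle
  refine h.not_ge (Real.sSup_le ?_ hβ)
  rintro _ ⟨x, hx, rfl⟩
  exact hle x hx

/-- A fuzzy set with closed cuts is upper semicontinuous. -/
theorem upperSemicontinuous_of_isClosed_cut {X : Type*} [TopologicalSpace X] {u : X → ℝ}
    (hu : ∀ x, u x ∈ Icc (0 : ℝ) 1) (hcut : ∀ α ∈ Icc (0 : ℝ) 1, IsClosed (cut u α)) :
    UpperSemicontinuous u := by
  rw [upperSemicontinuous_iff_isClosed_preimage]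
  intro α
  rcases le_or_gt α 0 with h0 | h0
  · convert isClosed_univ
    exact eq_univ_of_forall fun x => h0.trans (hu x).1
  rcases lt_or_ge 1 α with h1 | h1
  · convert isClosed_empty
    exact eq_empty_of_forall_notMem fun x hx => ((hu x).2.trans_lt h1).not_ge hx
  · have := hcut α ⟨h0.le, h1⟩
    rwa [cut, if_neg h0.ne'] at this

/-- If the cuts are compact, a positive supremum in the Zadeh extension is attained. -/
theorem exists_zadeh_le {X Y : Type*} [TopologicalSpace X] [T2Space X] [TopologicalSpace Y]
    [T1Space Y] {f : X → Y} (hf : Continuous f) {u : X → ℝ} (hu : ∀ x, u x ∈ Icc (0 : ℝ) 1)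
    (hcut : ∀ α ∈ Icc (0 : ℝ) 1, IsCompact (cut u α)) {y : Y} (hy : 0 < zadeh f u y) :
    ∃ x, f x = y ∧ zadeh f u y ≤ u x := by
  have husc := upperSemicontinuous_of_isClosed_cut hu fun α hα => (hcut α hα).isClosed
  obtain ⟨x₁, hx₁, hpos⟩ := exists_lt_of_lt_zadeh le_rfl hy
  have hK : IsCompact (cut u (u x₁) ∩ f ⁻¹' {y}) :=
    (hcut _ (hu x₁)).inter_right (isClosed_singleton.preimage hf)
  rw [cut, if_neg hpos.ne'] at hK
  have hne : ({x | u x₁ ≤ u x} ∩ f ⁻¹' {y}).Nonempty := ⟨x₁, le_refl (u x₁), hx₁⟩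
  obtain ⟨x₀, ⟨hx₀, hfx₀⟩, hmax⟩ :=
    UpperSemicontinuousOn.exists_isMaxOn hne hK
      (husc.upperSemicontinuousOn _)
  refine ⟨x₀, hfx₀, Real.sSup_le ?_ (hu x₀).1⟩
  rintro _ ⟨x, hx, rfl⟩
  rcases le_total (u x₁) (u x) with h | h
  · exact hmax ⟨h, hx⟩
  · exact h.trans hx₀

/-- Cuts of the Zadeh extension along a continuous map are the images of the cuts. -/
theorem cut_zadeh_eq_image {X Y : Type*} [TopologicalSpace X] [T2Space X] [TopologicalSpace Y]
    [T2Space Y] {f : X → Y} (hf : Continuous f) {u : X → ℝ} (hu : ∀ x, u x ∈ Icc (0 : ℝ) 1)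
    (hcut : ∀ α ∈ Icc (0 : ℝ) 1, IsCompact (cut u α)) {θ : ℝ} (hθ : θ ∈ Icc (0 : ℝ) 1) :
    cut (zadeh f u) θ = f '' cut u θ := by
  rcases eq_or_ne θ 0 with rfl | h0
  · have hc := hcut 0 hθ
    simp only [cut, if_true] at hc ⊢
    rw [image_closure_of_isCompact hc hf.continuousOn]
    congr 1
    ext y
    constructor
    · intro hy
      obtain ⟨x, hx, hpos⟩ := exists_lt_of_lt_zadeh le_rfl hy
      exact ⟨x, hpos, hx⟩
    · rintro ⟨x, hx, rfl⟩
      exact lt_of_lt_of_le hx (le_zadeh f hu x)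
  · simp only [cut, if_neg h0]
    ext y
    constructor
    · intro hy
      obtain ⟨x, hx, hle⟩ := exists_zadeh_le hf hu hcut ((hθ.1.lt_of_ne' h0).trans_le hy)
      exact ⟨x, le_trans hy hle, hx⟩
    · rintro ⟨x, hx, rfl⟩
      exact le_trans hx (le_zadeh f hu x)

theorem image_Icc_of_continuous_monotone {g : ℝ → ℝ} (hc : Continuous g) (hm : Monotone g)
    {a b : ℝ} (hab : a ≤ b) : g '' Icc a b = Icc (g a) (g b) :=
  Subset.antisymm (hm.monotoneOn _).image_Icc_subset (intermediate_value_Icc hab hc.continuousOn)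

theorem stmt15 {m : ℕ} (fi : Fin m → ℝ → ℝ)
    (hfc : ∀ i, Continuous (fi i)) (hfm : ∀ i, Monotone (fi i))
    (f : (Fin m → ℝ) → (Fin m → ℝ)) (hf : ∀ x i, f x i = fi i (x i))
    (u : (Fin m → ℝ) → ℝ) (hu : ∀ x, u x ∈ Icc (0 : ℝ) 1)
    (um up : ℝ → Fin m → ℝ)
    (huleb : ∀ θ ∈ Icc (0 : ℝ) 1, ∀ i, um θ i ≤ up θ i)
    (hucut : ∀ θ ∈ Icc (0 : ℝ) 1,
      cut u θ = Set.univ.pi (fun i => Icc (um θ i) (up θ i))) :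
    IsCellFuzzyNumber (zadeh f u) ∧
      ∀ θ ∈ Icc (0 : ℝ) 1,
        cut (zadeh f u) θ =
          Set.univ.pi (fun i => Icc (fi i (um θ i)) (fi i (up θ i))) := by
  have hcont : Continuous f :=
    continuous_pi fun i => by simpa only [hf, Function.comp_def] using (hfc i).comp (continuous_apply i)
  have hcut : ∀ α ∈ Icc (0 : ℝ) 1, IsCompact (cut u α) := fun α hα => by
    rw [hucut α hα]
    exact isCompact_univ_pi fun _ => isCompact_Icc
  have hfeq : f = Pi.map fi := funext fun x => funext (hf x)
  have key : ∀ θ ∈ Icc (0 : ℝ) 1, cut (zadeh f u) θ =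
      Set.univ.pi (fun i => Icc (fi i (um θ i)) (fi i (up θ i))) := fun θ hθ => by
    rw [cut_zadeh_eq_image hcont hu hcut hθ, hucut θ hθ, hfeq, piMap_image_univ_pi]
    exact congrArg _ (funext fun i => image_Icc_of_continuous_monotone (hfc i) (hfm i)
      (huleb θ hθ i))
  exact ⟨⟨zadeh_mem_Icc hu, fun α hα => ⟨_, _, fun k => hfm k (huleb α hα k), key α hα⟩⟩, key⟩
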